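/- Let h ≥ 1, m ≥ 2 and k ≥ 4 be integers. Then σ_{h,1,1}(T_{m,k}) = σ*_{h,1,1}(T_{m,k}) = max{h + 2m + 1, 2h + m}. -/

import Mathlib

open SimpleGraph

/-- An `L(h,p,p)`-labelling of `G` with span `ℓ`: labels in `{0,…,ℓ}`, labels of vertices at
distance 1 differ by at least `h`, labels of vertices at distance 2 or 3 differ by at least `p`. -/
def IsLLabelling {V : Type} (G : SimpleGraph V) (h p ℓ : ℕ) (f : V → ℕ) : Prop :=
  (∀ v, f v ≤ ℓ) ∧
  (∀ u v, G.dist u v = 1 → (h : ℤ) ≤ |(f u : ℤ) - (f v : ℤ)|) ∧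
  (∀ u v, G.dist u v = 2 ∨ G.dist u v = 3 → (p : ℤ) ≤ |(f u : ℤ) - (f v : ℤ)|)

/-- `λ_{h,p,p}(G)`: the minimum span of an `L(h,p,p)`-labelling of `G`. -/
noncomputable def lambdaNum {V : Type} (G : SimpleGraph V) (h p : ℕ) : ℕ :=
  sInf {ℓ : ℕ | ∃ f : V → ℕ, IsLLabelling G h p ℓ f}

/-- A circular interval modulo `n`: a set of residues of the form `{a, a+1, …, a+s}` mod `n`. -/
def IsCircInterval (n : ℕ) (I : Set (ZMod n)) : Prop :=
  ∃ (a : ZMod n) (s : ℕ), I = {x : ZMod n | ∃ i : ℕ, i ≤ s ∧ x = a + (i : ZMod n)}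

/-- An elegant `L(h,p,p)`-labelling: additionally each vertex `u` has a circular interval `I u`
modulo `ℓ+1` containing the labels of all neighbours of `u`, with `I u ∩ I v = ∅` for edges `uv`. -/
def IsElegantLLabelling {V : Type} (G : SimpleGraph V) (h p ℓ : ℕ) (f : V → ℕ) : Prop :=
  IsLLabelling G h p ℓ f ∧
  ∃ I : V → Set (ZMod (ℓ + 1)),
    (∀ u, IsCircInterval (ℓ + 1) (I u)) ∧
    (∀ u w, G.Adj u w → ((f w : ZMod (ℓ + 1)) ∈ I u)) ∧
    (∀ u v, G.Adj u v → I u ∩ I v = ∅)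

/-- `λ*_{h,p,p}(G)`: the minimum span of an elegant `L(h,p,p)`-labelling of `G`. -/
noncomputable def lambdaStar {V : Type} (G : SimpleGraph V) (h p : ℕ) : ℕ :=
  sInf {ℓ : ℕ | ∃ f : V → ℕ, IsElegantLLabelling G h p ℓ f}

/-- The `ℓ`-cyclic distance between labels `a` and `b`. -/
def cycDist (ℓ a b : ℕ) : ℤ :=
  min |(a : ℤ) - (b : ℤ)| ((ℓ : ℤ) - |(a : ℤ) - (b : ℤ)|)

/-- A `C(h,p,p)`-labelling of `G` with span `ℓ`: labels in `{0,…,ℓ-1}`, and the `ℓ`-cyclic distance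
between labels of vertices at distance 1 (resp. 2 or 3) is at least `h` (resp. `p`). -/
def IsCLabelling {V : Type} (G : SimpleGraph V) (h p ℓ : ℕ) (f : V → ℕ) : Prop :=
  (∀ v, f v < ℓ) ∧
  (∀ u v, G.dist u v = 1 → (h : ℤ) ≤ cycDist ℓ (f u) (f v)) ∧
  (∀ u v, G.dist u v = 2 ∨ G.dist u v = 3 → (p : ℤ) ≤ cycDist ℓ (f u) (f v))

/-- `σ_{h,p,p}(G)`: the minimum positive `ℓ` such that `G` has a `C(h,p,p)`-labelling of span `ℓ`. -/
noncomputable def sigmaNum {V : Type} (G : SimpleGraph V) (h p : ℕ) : ℕ :=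
  sInf {ℓ : ℕ | 0 < ℓ ∧ ∃ f : V → ℕ, IsCLabelling G h p ℓ f}

/-- An elegant `C(h,p,p)`-labelling: additionally each vertex `u` has a circular interval `I u`
modulo `ℓ` containing the labels of all neighbours of `u`, with `I u ∩ I v = ∅` for edges `uv`. -/
def IsElegantCLabelling {V : Type} (G : SimpleGraph V) (h p ℓ : ℕ) (f : V → ℕ) : Prop :=
  IsCLabelling G h p ℓ f ∧
  ∃ I : V → Set (ZMod ℓ),
    (∀ u, IsCircInterval ℓ (I u)) ∧
    (∀ u w, G.Adj u w → ((f w : ZMod ℓ) ∈ I u)) ∧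
    (∀ u v, G.Adj u v → I u ∩ I v = ∅)

/-- `σ*_{h,p,p}(G)`: the minimum positive `ℓ` such that `G` has an elegant `C(h,p,p)`-labelling
of span `ℓ`. -/
noncomputable def sigmaStar {V : Type} (G : SimpleGraph V) (h p : ℕ) : ℕ :=
  sInf {ℓ : ℕ | 0 < ℓ ∧ ∃ f : V → ℕ, IsElegantCLabelling G h p ℓ f}

/-- `Δ₂(G) = max over edges uv of (deg u + deg v)`. -/
noncomputable def deltaTwo {V : Type} (G : SimpleGraph V) [Fintype V] [DecidableRel G.Adj] : ℕ :=
  sSup {d : ℕ | ∃ u v : V, G.Adj u v ∧ d = G.degree u + G.degree v}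

/-- Cyclic distance at least `h` in terms of linear inequalities. -/
lemma le_cycDist_iff (ℓ h a b : ℕ) :
    (h : ℤ) ≤ cycDist ℓ a b ↔
      (a + h ≤ b ∨ b + h ≤ a) ∧ a + h ≤ ℓ + b ∧ b + h ≤ ℓ + a := by
  unfold cycDist
  rw [le_min_iff, le_abs, le_sub_comm (a := (h : ℤ)) (b := (ℓ : ℤ)), abs_le]
  omega

/-- A displacement by `t` with `h ≤ t ≤ ℓ - h` moves a residue by cyclic distance at least `h`. -/
lemma le_cycDist_val_add {ℓ : ℕ} [NeZero ℓ] (c : ZMod ℓ) {h t : ℕ} (hh : 1 ≤ h)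
    (ht : h ≤ t) (ht' : t + h ≤ ℓ) :
    (h : ℤ) ≤ cycDist ℓ c.val (c + (t : ZMod ℓ)).val := by
  rw [le_cycDist_iff]
  have hc := ZMod.val_lt c
  have htv : ((t : ZMod ℓ)).val = t := ZMod.val_cast_of_lt (by omega)
  by_cases hlt : c.val + t < ℓ
  · rw [ZMod.val_add_of_lt (by rwa [htv]), htv]
    omega
  · rw [ZMod.val_add_of_le (by rw [htv]; omega), htv]
    omega

lemma one_le_cycDist_of_ne {ℓ a b : ℕ} (ha : a < ℓ) (hb : b < ℓ) (hab : a ≠ b) :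
    ((1 : ℕ) : ℤ) ≤ cycDist ℓ a b := by
  rw [le_cycDist_iff]
  omega

namespace SimpleGraph

variable {V : Type} {G : SimpleGraph V}

/-- In a tree, a vertex has at most one neighbour closer to a given root. -/
lemma IsTree.eq_of_adj_of_dist_eq (hT : G.IsTree) (r : V) {v a b : V}
    (ha : G.Adj a v) (hb : G.Adj b v) (hda : G.dist r v = G.dist r a + 1)
    (hdb : G.dist r v = G.dist r b + 1) : a = b := by
  obtain ⟨p, hp⟩ := hT.connected.exists_walk_length_eq_dist r a
  obtain ⟨q, hq⟩ := hT.connected.exists_walk_length_eq_dist r b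
  have hp' : (p.concat ha).IsPath :=
    Walk.isPath_of_length_eq_dist _ (by rw [Walk.length_concat, hp, hda])
  have hq' : (q.concat hb).IsPath :=
    Walk.isPath_of_length_eq_dist _ (by rw [Walk.length_concat, hq, hdb])
  have := congrArg Walk.penultimate ((hT.existsUnique_path r v).unique hp' hq')
  simpa using this

/-- In a connected graph, every vertex other than the root has a neighbour closer to the root. -/
lemma Connected.exists_adj_dist_eq (hG : G.Connected) (r : V) {v : V} (hv : v ≠ r) :
    ∃ u, G.Adj u v ∧ G.dist r v = G.dist r u + 1 := by
  obtain ⟨p, hp⟩ := hG.exists_walk_length_eq_dist v r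
  cases p with
  | nil => exact absurd rfl hv
  | cons hadj q =>
    rename_i u
    refine ⟨u, hadj.symm, ?_⟩
    rw [Walk.length_cons] at hp
    have h1 := dist_le q
    have h2 := hG.dist_triangle (u := r) (v := u) (w := v)
    have h3 := dist_eq_one_iff_adj.mpr hadj.symm
    have h4 := G.dist_comm (u := r) (v := v)
    have h5 := G.dist_comm (u := r) (v := u)
    omega

/-- Two vertices at distance two have a common neighbour. -/
lemma exists_common_adj_of_dist_eq_two {u w : V} (huw : G.dist u w = 2) :
    ∃ v, G.Adj v u ∧ G.Adj v w := by
  obtain ⟨p, hp⟩ := exists_walk_of_dist_ne_zero (by omega : G.dist u w ≠ 0)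
  rw [huw] at hp
  match p, hp with
  | .cons h1 (.cons h2 .nil), _ => exact ⟨_, h1.symm, h2⟩

/-- Two vertices at distance three are joined by a walk with three edges. -/
lemma exists_adj_of_dist_eq_three {u w : V} (huw : G.dist u w = 3) :
    ∃ a b, G.Adj a u ∧ G.Adj a b ∧ G.Adj b w := by
  obtain ⟨p, hp⟩ := exists_walk_of_dist_ne_zero (by omega : G.dist u w ≠ 0)
  rw [huw] at hp
  match p, hp with
  | .cons h1 (.cons h2 (.cons h3 .nil)), _ => exact ⟨_, _, h1.symm, h2, h3⟩

/-- In a tree in which every vertex has at most `m` children, the residues modulo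
`ℓ ≥ max (h + 2 m + 1) (2 h + m)` can be spread greedily: the vertex `v` gets the residue `c v`,
its neighbours lie in the arc of `m + 1` residues starting at `c v + d v`, at position `i x` for a
child `x` and at position `p v` for the parent. -/
lemma IsTree.exists_greedy_labels (hT : G.IsTree) [Fintype V] (r : V) {h m ℓ : ℕ} (hh : 1 ≤ h)
    (h₁ : h + 2 * m + 1 ≤ ℓ) (h₂ : 2 * h + m ≤ ℓ)
    (hchild : ∀ v, {x | G.Adj v x ∧ G.dist r x = G.dist r v + 1}.ncard ≤ m) :
    ∃ (c : V → ZMod ℓ) (d p i : V → ℕ),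
      (∀ v, h ≤ d v ∧ d v + m + h ≤ ℓ) ∧
      (∀ v x, G.Adj v x → G.dist r x = G.dist r v + 1 →
        c x = c v + d v + i x ∧ c v = c x + d x + p x ∧ i x ≤ m ∧ p x ≤ m ∧ i x ≠ p v ∧
        m + 1 ≤ i x + d x ∧ i x + d x + m + 1 ≤ ℓ) ∧
      (∀ v x y, G.Adj v x → G.dist r x = G.dist r v + 1 →
        G.Adj v y → G.dist r y = G.dist r v + 1 → i x = i y → x = y) := by
  have hpar : ∀ x, ∃ u, x ≠ r → G.Adj u x ∧ G.dist r x = G.dist r u + 1 := fun x ↦ by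
    by_cases hx : x = r
    · exact ⟨r, fun h ↦ absurd hx h⟩
    · obtain ⟨u, hu⟩ := hT.connected.exists_adj_dist_eq r hx
      exact ⟨u, fun _ ↦ hu⟩
  choose par hpar using hpar
  have hidx : ∀ (v : V) (q : ℕ), ∃ e : V → ℕ,
      (∀ x, G.Adj v x → G.dist r x = G.dist r v + 1 → e x ≤ m ∧ e x ≠ q) ∧
      Set.InjOn e {x | G.Adj v x ∧ G.dist r x = G.dist r v + 1} := fun v q ↦ by
    have hle : {x | G.Adj v x ∧ G.dist r x = G.dist r v + 1}.encard ≤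
        (((Finset.range (m + 1)).erase q : Finset ℕ) : Set ℕ).encard := by
      rw [← (Set.toFinite _).cast_ncard_eq, Set.encard_coe_eq_coe_finsetCard]
      have hcard := Finset.pred_card_le_card_erase (s := Finset.range (m + 1)) (a := q)
      rw [Finset.card_range, Nat.add_sub_cancel] at hcard
      exact_mod_cast (hchild v).trans hcard
    obtain ⟨e, he, hinj⟩ := (Set.toFinite _).exists_injOn_of_encard_le hle
    refine ⟨e, fun x hx hx' ↦ ?_, hinj⟩
    have := he ⟨hx, hx'⟩
    simp only [Set.mem_preimage, Finset.mem_coe, Finset.mem_erase, Finset.mem_range] at this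
    omega
  choose e he hinj using hidx
  let step : ZMod ℓ × ℕ × ℕ → ℕ → ZMod ℓ × ℕ × ℕ := fun s j ↦
    let d' := max h (max (m + 1 - j) (ℓ - s.2.1 - j - m))
    (s.1 + s.2.1 + j, d', ℓ - s.2.1 - j - d')
  let st : ℕ → V → ZMod ℓ × ℕ × ℕ := fun n ↦ Nat.rec (fun _ ↦ (0, h, 0))
    (fun _ f x ↦ step (f (par x)) (e (par x) (f (par x)).2.2 x)) n
  let S : V → ZMod ℓ × ℕ × ℕ := fun v ↦ st (G.dist r v) v
  let i : V → ℕ := fun x ↦ e (par x) (S (par x)).2.2 x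
  have hparent : ∀ v x, G.Adj v x → G.dist r x = G.dist r v + 1 → par x = v := by
    intro v x hadj hd
    have hx : x ≠ r := by rintro rfl; simp at hd
    exact hT.eq_of_adj_of_dist_eq r (hpar x hx).1 hadj (hpar x hx).2 hd
  have hS : ∀ v x, G.Adj v x → G.dist r x = G.dist r v + 1 → S x = step (S v) (i x) := by
    intro v x hadj hd
    have hx := hparent v x hadj hd
    have : S x = st (G.dist r v + 1) x := by simp only [S, hd]
    rw [this]
    simp only [i, hx]
    change step (st (G.dist r v) (par x)) (e (par x) (st (G.dist r v) (par x)).2.2 x) = _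
    rw [hx]
  have hi : ∀ v x, G.Adj v x → G.dist r x = G.dist r v + 1 → i x ≤ m ∧ i x ≠ (S v).2.2 := by
    intro v x hadj hd
    simp only [i, hparent v x hadj hd]
    exact he v _ x hadj hd
  have hd : ∀ n v, G.dist r v = n → h ≤ (S v).2.1 ∧ (S v).2.1 + m + h ≤ ℓ := by
    intro n
    induction n with
    | zero =>
      intro v hv
      simp only [S, hv]
      change h ≤ h ∧ h + m + h ≤ ℓ
      omega
    | succ n ih =>
      intro v hv
      have hvr : v ≠ r := by rintro rfl; simp at hv
      obtain ⟨hadj, hdist⟩ := hpar v hvr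
      obtain ⟨ih₁, ih₂⟩ := ih (par v) (by omega)
      obtain ⟨hi₁, hi₂⟩ := hi _ v hadj hdist
      rw [hS _ v hadj hdist]
      simp only [step]
      omega
  refine ⟨fun v ↦ (S v).1, fun v ↦ (S v).2.1, fun v ↦ (S v).2.2, i, fun v ↦ hd _ v rfl, ?_, ?_⟩
  · intro v x hadj hdist
    obtain ⟨hd₁, hd₂⟩ := hd _ v rfl
    obtain ⟨hi₁, hi₂⟩ := hi _ x hadj hdist
    have hSx := hS _ x hadj hdist
    have hc : (S x).1 = (S v).1 + (S v).2.1 + i x := by rw [hSx]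
    have hdx : (S x).2.1 = max h (max (m + 1 - i x) (ℓ - (S v).2.1 - i x - m)) := by rw [hSx]
    have hpx : (S x).2.2 = ℓ - (S v).2.1 - i x - (S x).2.1 := by rw [hSx]
    have hsum : (S v).2.1 + i x + (S x).2.1 + (S x).2.2 = ℓ := by omega
    beta_reduce
    refine ⟨hc, ?_, hi₁, ?_, hi₂, ?_, ?_⟩
    · have hz : ((S v).2.1 + i x + (S x).2.1 + (S x).2.2 : ZMod ℓ) = 0 := by
        have := congrArg (Nat.cast : ℕ → ZMod ℓ) hsum
        simpa using this
      rw [hc]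
      linear_combination -hz
    all_goals omega
  · intro v x y hx hx' hy hy' hxy
    simp only [i, hparent v x hx hx', hparent v y hy hy'] at hxy
    exact hinj v _ ⟨hx, hx'⟩ ⟨hy, hy'⟩ hxy

/-- Elegant circular labellings of trees with few children per vertex. -/
lemma IsTree.exists_isElegantCLabelling (hT : G.IsTree) [Fintype V] (r : V) {h m ℓ : ℕ}
    (hh : 1 ≤ h) (h₁ : h + 2 * m + 1 ≤ ℓ) (h₂ : 2 * h + m ≤ ℓ)
    (hchild : ∀ v, {x | G.Adj v x ∧ G.dist r x = G.dist r v + 1}.ncard ≤ m) :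
    ∃ f : V → ℕ, IsElegantCLabelling G h 1 ℓ f := by
  have : NeZero ℓ := ⟨by omega⟩
  obtain ⟨c, d, p, i, hd, hci, hinj⟩ := hT.exists_greedy_labels r hh h₁ h₂ hchild
  let I : V → Set (ZMod ℓ) := fun v ↦ {x | ∃ j : ℕ, j ≤ m ∧ x = (c v + d v) + (j : ZMod ℓ)}
  have hmem : ∀ u w, G.Adj u w → c w ∈ I u := by
    intro u w hadj
    rcases hT.dist_eq_dist_add_one_of_adj r hadj with hdist | hdist
    · obtain ⟨-, hc, -, hp, -⟩ := hci w u hadj.symm hdist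
      exact ⟨p u, hp, hc⟩
    · obtain ⟨hc, -, hi, -⟩ := hci u w hadj hdist
      exact ⟨i w, hi, hc⟩
  have hcast : ∀ a b : ℕ, a < ℓ → b < ℓ → (a : ZMod ℓ) = b → a = b := by
    intro a b ha hb hab
    rw [ZMod.natCast_eq_natCast_iff] at hab
    exact Nat.ModEq.eq_of_lt_of_lt hab ha hb
  have hdisj_child : ∀ v x, G.Adj v x → G.dist r x = G.dist r v + 1 → Disjoint (I v) (I x) := by
    intro v x hadj hdist
    rw [Set.disjoint_left]
    rintro y ⟨j, hj, rfl⟩ ⟨j', hj', hy⟩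
    obtain ⟨hc, -, hi, -, -, hlo, hhi⟩ := hci v x hadj hdist
    have : ((j : ℕ) : ZMod ℓ) = ((i x + d x + j' : ℕ) : ZMod ℓ) := by
      push_cast
      rw [hc] at hy
      linear_combination hy
    have := hcast _ _ (by omega) (by omega) this
    omega
  have hdisj : ∀ u v, G.Adj u v → Disjoint (I u) (I v) := by
    intro u v hadj
    rcases hT.dist_eq_dist_add_one_of_adj r hadj with hdist | hdist
    · exact (hdisj_child v u hadj.symm hdist).symm
    · exact hdisj_child u v hadj hdist
  have hne : ∀ v x y, G.Adj v x → G.Adj v y → x ≠ y → c x ≠ c y := by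
    intro v x y hx hy hxy hcxy
    have hdv := hd v
    rcases hT.dist_eq_dist_add_one_of_adj r hx with hdx | hdx <;>
      rcases hT.dist_eq_dist_add_one_of_adj r hy with hdy | hdy
    · exact hxy (hT.eq_of_adj_of_dist_eq r hx.symm hy.symm hdx hdy)
    · obtain ⟨-, hcx, -, hp, -⟩ := hci x v hx.symm hdx
      obtain ⟨hcy, -, hi, -, hip, -⟩ := hci v y hy hdy
      refine hip (hcast _ _ (by omega) (by omega) ?_)
      linear_combination hcx - hcy - hcxy
    · obtain ⟨-, hcy, -, hp, -⟩ := hci y v hy.symm hdy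
      obtain ⟨hcx, -, hi, -, hip, -⟩ := hci v x hx hdx
      refine hip (hcast _ _ (by omega) (by omega) ?_)
      linear_combination hcy - hcx + hcxy
    · obtain ⟨hcx, -, hix, -⟩ := hci v x hx hdx
      obtain ⟨hcy, -, hiy, -⟩ := hci v y hy hdy
      refine hxy (hinj v x y hx hdx hy hdy (hcast _ _ (by omega) (by omega) ?_))
      linear_combination hcy - hcx + hcxy
  refine ⟨fun v ↦ (c v).val, ⟨fun v ↦ ZMod.val_lt _, ?_, ?_⟩, I, ?_, ?_, ?_⟩
  · intro u v huv
    obtain ⟨j, hj, hc⟩ := hmem u v (dist_eq_one_iff_adj.mp huv)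
    have hdu := hd u
    have := le_cycDist_val_add (c u) (t := d u + j) hh (by omega) (by omega)
    rwa [Nat.cast_add, ← add_assoc, ← hc] at this
  · intro u v huv
    refine one_le_cycDist_of_ne (ZMod.val_lt _) (ZMod.val_lt _) fun hval ↦ ?_
    have hcuv := ZMod.val_injective ℓ hval
    rcases huv with huv | huv
    · obtain ⟨w, hwu, hwv⟩ := exists_common_adj_of_dist_eq_two huv
      exact hne w u v hwu hwv (by rintro rfl; simp at huv) hcuv
    · obtain ⟨a, b, hau, hab, hbv⟩ := exists_adj_of_dist_eq_three huv
      exact Set.disjoint_left.mp (hdisj a b hab) (hmem a u hau) (hcuv ▸ hmem b v hbv)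
  · exact fun u ↦ ⟨c u + d u, m, rfl⟩
  · intro u w hadj
    simpa using hmem u w hadj
  · exact fun u v hadj ↦ Set.disjoint_iff_inter_eq_empty.mp (hdisj u v hadj)

/-- A vertex of degree `m + 1`, all of whose neighbours have degree `m + 1`, forces a large span. -/
lemma IsTree.le_span_of_isCLabelling (hT : G.IsTree) [Fintype V] [DecidableRel G.Adj]
    {h m ℓ : ℕ} (hh : 1 ≤ h) {v : V} (hv : G.degree v = m + 1)
    (hnbr : ∀ w, G.Adj v w → G.degree w = m + 1) {f : V → ℕ} (hf : IsCLabelling G h 1 ℓ f) :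
    max (h + 2 * m + 1) (2 * h + m) ≤ ℓ := by
  classical
  obtain ⟨hlt, hadj, hdist⟩ := hf
  simp only [le_cycDist_iff] at hadj hdist
  -- labels measured clockwise from the label of `v`
  let g : V → ℕ := fun x ↦ if f v ≤ f x then f x - f v else f x + ℓ - f v
  have hg : ∀ x, g x < ℓ ∧ (g x + f v = f x ∨ g x + f v = f x + ℓ) := fun x ↦ by
    have := hlt x
    have := hlt v
    simp only [g]
    split_ifs <;> omega
  have hgv : g v = 0 := by simp [g]
  have hsep : ∀ x y, G.dist x y ≤ 3 → x ≠ y → g x ≠ g y := by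
    intro x y hxy hne hgxy
    have hpos := hT.connected.pos_dist_of_ne hne
    have hx := hg x
    have hy := hg y
    have hx' := hlt x
    have hy' := hlt y
    obtain h1 | h1 : G.dist x y = 1 ∨ (G.dist x y = 2 ∨ G.dist x y = 3) := by omega
    · have := hadj x y h1
      omega
    · have := hdist x y h1
      omega
  have hgadj : ∀ x y, G.Adj x y →
      (g x + h ≤ g y ∨ g y + h ≤ g x) ∧ g x + h ≤ ℓ + g y ∧ g y + h ≤ ℓ + g x := by
    intro x y hxy
    have := hadj x y (dist_eq_one_iff_adj.mpr hxy)
    have hx := hg x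
    have hy := hg y
    omega
  have hinj : ∀ u, Set.InjOn g (G.neighborFinset u) := by
    intro u x hx y hy hxy
    by_contra hne
    simp only [Finset.mem_coe, mem_neighborFinset] at hx hy
    have := hT.connected.dist_triangle (u := x) (v := u) (w := y)
    have hx' := dist_eq_one_iff_adj.mpr hx.symm
    have hy' := dist_eq_one_iff_adj.mpr hy
    exact hsep x y (by omega) hne hxy
  have hcard : ∀ u, ((G.neighborFinset u).image g).card = G.degree u := fun u ↦ by
    rw [Finset.card_image_of_injOn (hinj u), card_neighborFinset_eq_degree]
  refine max_le ?_ ?_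
  · have hne : (G.neighborFinset v).Nonempty := by
      rw [← Finset.card_pos, card_neighborFinset_eq_degree]
      omega
    obtain ⟨w, hw, hmin⟩ := Finset.exists_min_image _ g hne
    rw [mem_neighborFinset] at hw
    have hgw := hgadj v w hw
    have hdisj : Disjoint ((G.neighborFinset v).image g) ((G.neighborFinset w).image g) := by
      rw [Finset.disjoint_left]
      simp only [Finset.mem_image, mem_neighborFinset]
      rintro _ ⟨x, hx, rfl⟩ ⟨y, hy, hyx⟩
      have h1 := hT.connected.dist_triangle (u := y) (v := w) (w := x)
      have h2 := hT.connected.dist_triangle (u := w) (v := v) (w := x)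
      have h3 := dist_eq_one_iff_adj.mpr hx
      have h4 := dist_eq_one_iff_adj.mpr hy.symm
      have h5 := dist_eq_one_iff_adj.mpr hw.symm
      refine hsep y x (by omega) ?_ hyx
      rintro rfl
      have := hT.dist_eq_dist_add_one_of_adj v hy
      have := dist_eq_one_iff_adj.mpr hw
      omega
    have hdisj' : Disjoint ((G.neighborFinset v).image g ∪ (G.neighborFinset w).image g)
        (Finset.Ico (g w + 1 - h) (g w)) := by
      rw [Finset.disjoint_union_left, Finset.disjoint_left, Finset.disjoint_left]
      simp only [Finset.mem_image, mem_neighborFinset, Finset.mem_Ico]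
      constructor
      · rintro _ ⟨x, hx, rfl⟩
        have := hmin x (by simpa using hx)
        omega
      · rintro _ ⟨x, hx, rfl⟩
        have := hgadj w x hx
        omega
    have hsub : ((G.neighborFinset v).image g ∪ (G.neighborFinset w).image g) ∪
        Finset.Ico (g w + 1 - h) (g w) ⊆ Finset.range ℓ := by
      intro y hy
      simp only [Finset.mem_union, Finset.mem_image, Finset.mem_Ico] at hy
      rw [Finset.mem_range]
      rcases hy with (⟨x, -, rfl⟩ | ⟨x, -, rfl⟩) | hy
      · exact (hg x).1
      · exact (hg x).1
      · exact hy.2.trans (hg w).1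
    have hle := Finset.card_le_card hsub
    rw [Finset.card_union_of_disjoint hdisj', Finset.card_union_of_disjoint hdisj, hcard, hcard,
      hv, hnbr w hw, Nat.card_Ico, Finset.card_range] at hle
    omega
  · have hsub : (G.neighborFinset v).image g ⊆ Finset.Ico h (ℓ + 1 - h) := by
      intro y hy
      simp only [Finset.mem_image, mem_neighborFinset] at hy
      obtain ⟨x, hx, rfl⟩ := hy
      have := hgadj v x hx
      rw [Finset.mem_Ico]
      omega
    have hle := Finset.card_le_card hsub
    rw [hcard, hv, Nat.card_Ico] at hle
    omega

end SimpleGraph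

theorem stmt17 {V : Type} [Fintype V] (G : SimpleGraph V) [DecidableRel G.Adj]
    (hT : G.IsTree) (m k : ℕ) (hm : 2 ≤ m) (hk : 4 ≤ k) (r : V)
    (hr : G.degree r = m)
    (hdeg : ∀ v : V, 1 ≤ G.dist r v → G.dist r v ≤ k - 1 → G.degree v = m + 1)
    (hball : ∀ v : V, G.dist r v ≤ k)
    (h : ℕ) (hh : 1 ≤ h) :
    sigmaNum G h 1 = max (h + 2 * m + 1) (2 * h + m) ∧
    sigmaStar G h 1 = max (h + 2 * m + 1) (2 * h + m) := by
  have hchild : ∀ v, {x | G.Adj v x ∧ G.dist r x = G.dist r v + 1}.ncard ≤ m := by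
    classical
    intro v
    have hfin : {x | G.Adj v x ∧ G.dist r x = G.dist r v + 1} =
        ((G.neighborFinset v).filter fun x ↦ G.dist r x = G.dist r v + 1 : Finset V) := by
      ext x
      simp
    rw [hfin, Set.ncard_coe_finset]
    by_cases hvr : v = r
    · subst hvr
      exact (Finset.card_filter_le _ _).trans (by rw [card_neighborFinset_eq_degree, hr])
    · by_cases hvk : G.dist r v ≤ k - 1
      · obtain ⟨u, hu, hdu⟩ := hT.connected.exists_adj_dist_eq r hvr
        have hlt : ((G.neighborFinset v).filter fun x ↦ G.dist r x = G.dist r v + 1).card <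
            (G.neighborFinset v).card := by
          refine Finset.card_lt_card (Finset.filter_ssubset.mpr ⟨u, by simpa using hu.symm, ?_⟩)
          omega
        rw [card_neighborFinset_eq_degree, hdeg v (by omega) hvk] at hlt
        omega
      · rw [Finset.filter_eq_empty_iff.mpr]
        · simp
        · intro x _
          have := hball x
          omega
  obtain ⟨v, hv⟩ : ∃ v, G.dist r v = 2 := by
    obtain ⟨u, hu⟩ := (G.degree_pos_iff_exists_adj r).mp (by omega)
    have hdu := dist_eq_one_iff_adj.mpr hu
    have hdegu := hdeg u (by omega) (by omega)
    obtain ⟨w, hw, hwr⟩ := Finset.exists_mem_ne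
      (s := G.neighborFinset u) (by rw [card_neighborFinset_eq_degree]; omega) r
    rw [mem_neighborFinset] at hw
    refine ⟨w, ?_⟩
    have := hT.dist_eq_dist_add_one_of_adj r hw
    have := hT.connected.pos_dist_of_ne hwr.symm
    omega
  have hlower : ∀ (ℓ : ℕ) (f : V → ℕ), IsCLabelling G h 1 ℓ f →
      max (h + 2 * m + 1) (2 * h + m) ≤ ℓ := by
    intro ℓ f hf
    refine hT.le_span_of_isCLabelling hh (hdeg v (by omega) (by omega)) (fun w hw ↦ ?_) hf
    have := hT.dist_eq_dist_add_one_of_adj r hw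
    exact hdeg w (by omega) (by omega)
  obtain ⟨f, hf⟩ := hT.exists_isElegantCLabelling r hh (le_max_left _ _) (le_max_right _ _) hchild
  have hpos : 0 < max (h + 2 * m + 1) (2 * h + m) := by omega
  constructor
  · exact IsLeast.csInf_eq ⟨⟨hpos, f, hf.1⟩, fun ℓ ⟨_, f', hf'⟩ ↦ hlower ℓ f' hf'⟩
  · exact IsLeast.csInf_eq ⟨⟨hpos, f, hf⟩, fun ℓ ⟨_, f', hf'⟩ ↦ hlower ℓ f' hf'.1⟩
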